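/- arXiv:2311.03683 — 2 statements merged into one kernel-verified Lean document; each statement's English description precedes it below -/
import Mathlib

section
/- Let k ≥ 2, let z : Fin k → (ℝ^n → ℝ) be arbitrary logit functions, and let x ∈ ℝ^n. Define the softmax probability P(c | x) = exp(z_c(x)) / Σ_{c'=1}^{k} exp(z_{c'}(x)). If for a fixed class c and every class c' ≠ c the function t ↦ z_{c'}(t • x) − z_c(t • x) tends to −∞ as t → ∞, then the function t ↦ P(c | t • x) tends to 1 as t → ∞. -/
open Filter Real

/-- If for every class `c' ≠ c` the logit gap `z c' - z c` tends to `-∞` along the ray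
`t • x`, then the softmax probability of class `c` tends to 1. -/
theorem logit_gaps_bot_implies_softmax_limit_one
    {n k : ℕ} (hk : 2 ≤ k)
    (z : Fin k → EuclideanSpace ℝ (Fin n) → ℝ)
    (x : EuclideanSpace ℝ (Fin n)) (c : Fin k)
    (h : ∀ c' : Fin k, c' ≠ c →
      Tendsto (fun t : ℝ => z c' (t • x) - z c (t • x)) atTop atBot) :
    Tendsto
      (fun t : ℝ =>
        Real.exp (z c (t • x)) / ∑ c' : Fin k, Real.exp (z c' (t • x)))
      atTop (nhds 1) := by
  have hsum : Tendsto (fun t : ℝ => ∑ c' : Fin k, Real.exp (z c' (t • x) - z c (t • x)))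
      atTop (nhds (∑ c' : Fin k, if c' = c then 1 else 0)) := by
    refine tendsto_finsetSum _ fun c' _ => ?_
    by_cases hc : c' = c
    · simp [hc]
    · simpa [hc] using h c' hc
  rw [Finset.sum_ite_eq' Finset.univ c, if_pos (Finset.mem_univ c)] at hsum
  have hinv := hsum.inv₀ one_ne_zero
  rw [inv_one] at hinv
  refine hinv.congr fun t => ?_
  simp_rw [Real.exp_sub]
  rw [← Finset.sum_div, inv_div]
end

section
/- Let Q : Fin R → Set (ℝ^n) be a finite family of convex sets whose union is all of ℝ^n (for instance, the linear regions, which are polytopes, of a ReLU network). Then for every x ∈ ℝ^n there exist an index r ∈ Fin R and a real number α > 0 such that for all t ≥ α, the point t • x lies in Q r. -/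
open Filter

/-- If a finite family of convex sets covers `ℝ^n`, then for every `x` there is one set
of the family and a threshold `α > 0` such that `t • x` lies in that set for all
`t ≥ α`. -/
theorem ray_eventually_in_convex_piece
    {n R : ℕ} (Q : Fin R → Set (EuclideanSpace ℝ (Fin n)))
    (hconv : ∀ r, Convex ℝ (Q r))
    (hcover : (⋃ r, Q r) = Set.univ) :
    ∀ x : EuclideanSpace ℝ (Fin n),
      ∃ (r : Fin R) (α : ℝ), 0 < α ∧ ∀ t : ℝ, α ≤ t → t • x ∈ Q r := by
  intro x
  have hfreq : ∃ r, ∃ᶠ t : ℝ in atTop, t • x ∈ Q r := by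
    by_contra! h
    obtain ⟨t, ht⟩ := (eventually_all.2 h).exists
    obtain ⟨r, hr⟩ := Set.mem_iUnion.1 (hcover ▸ Set.mem_univ (t • x))
    exact ht r hr
  obtain ⟨r, hr⟩ := hfreq
  have hord : ((fun t : ℝ => t • x) ⁻¹' Q r).OrdConnected :=
    ((hconv r).is_linear_preimage
      (LinearMap.toSpanSingleton ℝ _ x).isLinear).ordConnected
  obtain ⟨α, hα, hαr⟩ := frequently_atTop.1 hr 1
  refine ⟨r, α, by linarith, fun t ht => ?_⟩
  obtain ⟨s, hts, hs⟩ := frequently_atTop.1 hr t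
  exact hord.out hαr hs ⟨ht, hts⟩
end
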